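/- Let γ > 0 and T(z) = z - Π_S(z) + M_γ⁻¹(2Π_S(z) - z). If z ∈ ℝ^{n+m} satisfies T(z) = z, then the projected point ẑ = Π_S(z) is a Nash equilibrium, i.e. ẑ ∈ S and ⟨F(ẑ), z' - ẑ⟩ ≥ 0 for all z' ∈ S. -/

import Mathlib

open Matrix
open scoped InnerProductSpace

noncomputable section

/-- The probability simplex `Δᵈ = {x ∈ ℝᵈ : xᵢ ≥ 0, ∑ᵢ xᵢ = 1}` in Euclidean space. -/
def simplex (d : ℕ) : Set (EuclideanSpace ℝ (Fin d)) :=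
  {x | (∀ i, 0 ≤ x i) ∧ ∑ i, x i = 1}

/-- `S = Δⁿ × Δᵐ ⊆ ℝ^{n+m}`, with coordinates indexed by `Fin n ⊕ Fin m`. -/
def gameSet (n m : ℕ) : Set (EuclideanSpace ℝ (Fin n ⊕ Fin m)) :=
  {z | (∀ i, 0 ≤ z i) ∧ (∑ i : Fin n, z (Sum.inl i)) = 1 ∧ (∑ j : Fin m, z (Sum.inr j)) = 1}

/-- The skew block matrix `K = [[0, A], [-Aᵀ, 0]]`. -/
def Kmat {n m : ℕ} (A : Matrix (Fin n) (Fin m) ℝ) :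
    Matrix (Fin n ⊕ Fin m) (Fin n ⊕ Fin m) ℝ :=
  Matrix.fromBlocks 0 A (-Aᵀ) 0

/-- The block matrix `M_γ = [[I, γA], [-γAᵀ, I]] = I + γK`. -/
def Mmat {n m : ℕ} (A : Matrix (Fin n) (Fin m) ℝ) (γ : ℝ) :
    Matrix (Fin n ⊕ Fin m) (Fin n ⊕ Fin m) ℝ :=
  1 + γ • Kmat A

/-- The game operator `F(x, y) = (A y, -Aᵀ x)`. -/
def Fop {n m : ℕ} (A : Matrix (Fin n) (Fin m) ℝ)
    (z : EuclideanSpace ℝ (Fin n ⊕ Fin m)) : EuclideanSpace ℝ (Fin n ⊕ Fin m) :=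
  Matrix.toEuclideanLin (Kmat A) z

/-- The operator (spectral) norm of a matrix, induced by Euclidean norms. -/
def opNorm {n m : ℕ} (A : Matrix (Fin n) (Fin m) ℝ) : ℝ :=
  ‖LinearMap.toContinuousLinearMap (Matrix.toEuclideanLin A)‖

/-- The duality gap `gap(x, y) = max_{y'∈Δᵐ} xᵀAy' - min_{x'∈Δⁿ} x'ᵀAy`. -/
def gap {n m : ℕ} (A : Matrix (Fin n) (Fin m) ℝ)
    (z : EuclideanSpace ℝ (Fin n ⊕ Fin m)) : ℝ :=
  sSup ((fun y' : EuclideanSpace ℝ (Fin m) =>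
      ∑ i : Fin n, ∑ j : Fin m, z (Sum.inl i) * A i j * y' j) '' simplex m)
    - sInf ((fun x' : EuclideanSpace ℝ (Fin n) =>
      ∑ i : Fin n, ∑ j : Fin m, x' i * A i j * z (Sum.inr j)) '' simplex n)

theorem convex_gameSet (n m : ℕ) : Convex ℝ (gameSet n m) := by
  rintro x ⟨hx, hx₁, hx₂⟩ y ⟨hy, hy₁, hy₂⟩ a b ha hb hab
  refine ⟨fun i => ?_, ?_, ?_⟩
  · have := hx i
    have := hy i
    simp only [PiLp.add_apply, PiLp.smul_apply, smul_eq_mul]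
    positivity
  · simp [Finset.sum_add_distrib, ← Finset.mul_sum, hx₁, hy₁, hab]
  · simp [Finset.sum_add_distrib, ← Finset.mul_sum, hx₂, hy₂, hab]

theorem transpose_Kmat {n m : ℕ} (A : Matrix (Fin n) (Fin m) ℝ) : (Kmat A)ᵀ = -Kmat A := by
  simp [Kmat, Matrix.fromBlocks_transpose, Matrix.fromBlocks_neg]

theorem dotProduct_Kmat_mulVec_self {n m : ℕ} (A : Matrix (Fin n) (Fin m) ℝ)
    (x : Fin n ⊕ Fin m → ℝ) : x ⬝ᵥ (Kmat A *ᵥ x) = 0 := by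
  have h : x ⬝ᵥ (Kmat A *ᵥ x) = -(x ⬝ᵥ (Kmat A *ᵥ x)) := by
    conv_lhs => rw [Matrix.dotProduct_mulVec, ← Matrix.mulVec_transpose, transpose_Kmat,
      Matrix.neg_mulVec, neg_dotProduct, dotProduct_comm]
  linarith

theorem isUnit_Mmat {n m : ℕ} (A : Matrix (Fin n) (Fin m) ℝ) (γ : ℝ) : IsUnit (Mmat A γ) := by
  rw [← Matrix.mulVec_injective_iff_isUnit]
  refine (injective_iff_map_eq_zero (Mmat A γ).mulVecLin).2 fun x hx => ?_
  have h : x ⬝ᵥ (Mmat A γ *ᵥ x) = 0 := by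
    rw [← Matrix.mulVecLin_apply, hx, dotProduct_zero]
  rw [Mmat, Matrix.add_mulVec, Matrix.one_mulVec, Matrix.smul_mulVec, dotProduct_add,
    dotProduct_smul, dotProduct_Kmat_mulVec_self, smul_zero, add_zero] at h
  exact dotProduct_self_eq_zero.1 h

theorem toEuclideanLin_Mmat {n m : ℕ} (A : Matrix (Fin n) (Fin m) ℝ) (γ : ℝ)
    (x : EuclideanSpace ℝ (Fin n ⊕ Fin m)) :
    Matrix.toEuclideanLin (Mmat A γ) x = x + γ • Fop A x := by
  ext i
  simp [Mmat, Fop]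

theorem toEuclideanLin_Mmat_inv {n m : ℕ} (A : Matrix (Fin n) (Fin m) ℝ) (γ : ℝ)
    (x : EuclideanSpace ℝ (Fin n ⊕ Fin m)) :
    Matrix.toEuclideanLin (Mmat A γ) (Matrix.toEuclideanLin (Mmat A γ)⁻¹ x) = x := by
  have h := Matrix.mul_nonsing_inv (Mmat A γ)
    ((Matrix.isUnit_iff_isUnit_det _).1 (isUnit_Mmat A γ))
  ext i
  simp [h]

theorem inner_sub_nearest_nonpos {E : Type*} [NormedAddCommGroup E] [InnerProductSpace ℝ E]
    {K : Set E} (hK : Convex ℝ K) {u v : E} (hv : v ∈ K) (h : ∀ w ∈ K, ‖u - v‖ ≤ ‖u - w‖)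
    {w : E} (hw : w ∈ K) : ⟪u - v, w - v⟫_ℝ ≤ 0 := by
  have : Nonempty K := ⟨⟨v, hv⟩⟩
  refine (norm_eq_iInf_iff_real_inner_le_zero hK hv).1 (le_antisymm ?_ ?_) w hw
  · exact le_ciInf fun w => h w w.2
  · exact ciInf_le (f := fun w : K => ‖u - w‖)
      ⟨0, by rintro _ ⟨w, rfl⟩; exact norm_nonneg _⟩ ⟨v, hv⟩

theorem fixed_point_proj_is_nash {n m : ℕ} (A : Matrix (Fin n) (Fin m) ℝ)
    (γ : ℝ) (hγ : 0 < γ)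
    (proj : EuclideanSpace ℝ (Fin n ⊕ Fin m) → EuclideanSpace ℝ (Fin n ⊕ Fin m))
    (hproj : ∀ z, proj z ∈ gameSet n m ∧ ∀ w ∈ gameSet n m, ‖z - proj z‖ ≤ ‖z - w‖)
    (T : EuclideanSpace ℝ (Fin n ⊕ Fin m) → EuclideanSpace ℝ (Fin n ⊕ Fin m))
    (hT : ∀ z, T z = z - proj z +
      Matrix.toEuclideanLin (Mmat A γ)⁻¹ ((2 : ℝ) • proj z - z))
    (z : EuclideanSpace ℝ (Fin n ⊕ Fin m)) (hz : T z = z) :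
    proj z ∈ gameSet n m ∧
      ∀ z' ∈ gameSet n m, 0 ≤ ⟪Fop A (proj z), z' - proj z⟫_ℝ := by
  refine ⟨(hproj z).1, fun z' hz' => ?_⟩
  have hfix : Matrix.toEuclideanLin (Mmat A γ)⁻¹ ((2 : ℝ) • proj z - z) = proj z := by
    have h := (hT z).symm.trans hz
    rw [sub_add_eq_add_sub, sub_eq_iff_eq_add] at h
    exact add_left_cancel h
  have hres : z - proj z = -(γ • Fop A (proj z)) := by
    have h := toEuclideanLin_Mmat_inv A γ ((2 : ℝ) • proj z - z)
    rw [hfix, toEuclideanLin_Mmat, two_smul, add_sub_assoc] at h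
    rw [add_left_cancel h, neg_sub]
  have h := inner_sub_nearest_nonpos (convex_gameSet n m) (hproj z).1 (hproj z).2 hz'
  rw [hres, inner_neg_left, real_inner_smul_left, neg_nonpos] at h
  exact nonneg_of_mul_nonneg_right h hγ

end
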